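/- Let G be a finite connected distance-hereditary graph with diam(G) = 2·rad(G) − 2, and let M be a subset of C(G) such that every two distinct vertices u,v ∈ M satisfy d(u,v) = 2. Then there exists a vertex c ∈ C(G) adjacent to every vertex of M. -/

import Mathlib

/-- A graph is distance-hereditary if every connected induced subgraph is isometric
(equivalently, every induced path is a shortest path). -/
def DistHereditary {V : Type*} (G : SimpleGraph V) : Prop :=
  ∀ s : Set V, (G.induce s).Connected →
    ∀ u v : s, (G.induce s).dist u v = G.dist (u : V) (v : V)

/-- Eccentricity of a vertex: `e(v) = max_{u} d(v,u)`. -/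
noncomputable def ecc {V : Type*} [Fintype V] (G : SimpleGraph V) (v : V) : ℕ :=
  Finset.univ.sup (fun u => G.dist v u)

/-- Radius: minimum eccentricity. -/
noncomputable def rad {V : Type*} [Fintype V] (G : SimpleGraph V) : ℕ :=
  sInf (Set.range (ecc G))

/-- Diameter: maximum eccentricity. -/
noncomputable def diam {V : Type*} [Fintype V] (G : SimpleGraph V) : ℕ :=
  Finset.univ.sup (fun v => ecc G v)

/-- The center: vertices of minimum eccentricity. -/
def center {V : Type*} [Fintype V] (G : SimpleGraph V) : Set V :=
  {v | ecc G v = rad G}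

/-- Distance from a vertex to a set of vertices: `d(v,S) = min_{s ∈ S} d(v,s)`. -/
noncomputable def distToSet {V : Type*} (G : SimpleGraph V) (v : V) (S : Set V) : ℕ :=
  sInf ((G.dist v) '' S)

/-- The interval `I(x,y)`: vertices on shortest `(x,y)`-paths. -/
def interval {V : Type*} (G : SimpleGraph V) (x y : V) : Set V :=
  {v | G.dist x v + G.dist v y = G.dist x y}

/-- The intervalSlice `S_k(x,y) = {v ∈ I(x,y) : d(x,v) = k}`. -/
def intervalSlice {V : Type*} (G : SimpleGraph V) (x y : V) (k : ℕ) : Set V :=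
  {v | v ∈ interval G x y ∧ G.dist x v = k}

/-- The set `S` induces a cograph in `G`: no induced path on four vertices within `S`. -/
def IsCographOn {V : Type*} (G : SimpleGraph V) (S : Set V) : Prop :=
  ¬ ∃ a b c d : V, a ∈ S ∧ b ∈ S ∧ c ∈ S ∧ d ∈ S ∧
    a ≠ c ∧ a ≠ d ∧ b ≠ d ∧
    G.Adj a b ∧ G.Adj b c ∧ G.Adj c d ∧ ¬ G.Adj a c ∧ ¬ G.Adj a d ∧ ¬ G.Adj b d

namespace SimpleGraph

variable {V : Type*} {G : SimpleGraph V}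

lemma exists_adj_dist_eq {u v : V} {n : ℕ} (h : G.dist u v = n + 1) :
    ∃ w, G.Adj u w ∧ G.dist w v = n := by
  have hr : G.Reachable u v := Reachable.of_dist_ne_zero (by omega)
  obtain ⟨p, hp⟩ := hr.exists_walk_length_eq_dist
  cases p with
  | nil => simp_all
  | @cons _ w _ ha q =>
    refine ⟨w, ha, ?_⟩
    have h1 := dist_le q
    have h2 : G.dist u v ≤ G.dist u w + G.dist w v := ha.reachable.dist_triangle_left v
    rw [dist_eq_one_iff_adj.2 ha] at h2
    simp only [Walk.length_cons] at hp
    omega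

lemma Connected.dist_le_succ_of_adj (hG : G.Connected) {u w : V} (h : G.Adj u w) (v : V) :
    G.dist u v ≤ G.dist w v + 1 := by
  have h2 := hG.dist_triangle (u := u) (v := w) (w := v)
  rw [dist_eq_one_iff_adj.2 h] at h2
  omega

lemma Connected.dist_le_two (hG : G.Connected) {u w v : V} (h : G.Adj u w) (h' : G.Adj w v) :
    G.dist u v ≤ 2 := by
  have h1 := hG.dist_le_succ_of_adj h v
  have h2 := dist_eq_one_iff_adj.2 h'
  omega

lemma Connected.reachable_induce_of_ball_subset (hG : G.Connected) {s : Set V} {v : V} {k : ℕ}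
    (hs : ∀ z, G.dist z v ≤ k → z ∈ s) {y : V} (hy : y ∈ s) (hv : v ∈ s) (h : G.dist y v ≤ k) :
    (G.induce s).Reachable ⟨y, hy⟩ ⟨v, hv⟩ := by
  induction hn : G.dist y v generalizing y with
  | zero =>
    obtain rfl := hG.dist_eq_zero_iff.1 hn
    exact Reachable.refl _
  | succ n ih =>
    obtain ⟨w, hw, hwn⟩ := exists_adj_dist_eq hn
    have hwk : G.dist w v ≤ k := by omega
    have ha : (G.induce s).Adj ⟨y, hy⟩ ⟨w, hs w hwk⟩ := hw
    exact ha.reachable.trans (ih (hs w hwk) hwk hwn)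

lemma connected_induce_of_reachable {s : Set V} {v : V} (hv : v ∈ s)
    (h : ∀ y (hy : y ∈ s), (G.induce s).Reachable ⟨y, hy⟩ ⟨v, hv⟩) : (G.induce s).Connected :=
  connected_iff_exists_forall_reachable _ |>.2 ⟨⟨v, hv⟩, fun y => (h y.1 y.2).symm⟩

/-- Two points at distance at most `a + 1 + b` admit adjacent or equal points in their balls of
radii `a` and `b`. -/
lemma Connected.exists_near_balls (hG : G.Connected) {v v' : V} {a b : ℕ}
    (h : G.dist v v' ≤ a + 1 + b) :
    ∃ y z, G.dist y v ≤ a ∧ G.dist z v' ≤ b ∧ (y = z ∨ G.Adj y z) := by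
  induction a generalizing v with
  | zero =>
    rcases Nat.eq_zero_or_eq_succ_pred (G.dist v v') with h0 | h0
    · exact ⟨v, v, by simp, by omega, Or.inl rfl⟩
    · obtain ⟨w, hw, hwn⟩ := exists_adj_dist_eq h0
      exact ⟨v, w, by simp, by omega, Or.inr hw⟩
  | succ a ih =>
    rcases Nat.eq_zero_or_eq_succ_pred (G.dist v v') with h0 | h0
    · exact ⟨v, v, by simp, by omega, Or.inl rfl⟩
    · obtain ⟨w, hw, hwn⟩ := exists_adj_dist_eq h0
      obtain ⟨y, z, hy, hz, hyz⟩ := ih (v := w) (by omega)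
      refine ⟨y, z, ?_, hz, hyz⟩
      have h1 := hG.dist_le_succ_of_adj hw y
      rw [G.dist_comm, G.dist_comm (u := w)] at h1
      omega

end SimpleGraph

namespace DistHereditary

open SimpleGraph

variable {V : Type*} {G : SimpleGraph V}

lemma exists_common_neighbor (hdh : DistHereditary G) {s : Set V} (hs : (G.induce s).Connected)
    {u w : V} (hu : u ∈ s) (hw : w ∈ s) (h : G.dist u w = 2) :
    ∃ z ∈ s, G.Adj u z ∧ G.Adj z w := by
  have h1 : (G.induce s).dist ⟨u, hu⟩ ⟨w, hw⟩ = 1 + 1 := (hdh s hs _ _).trans h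
  obtain ⟨z, hz, hz'⟩ := exists_adj_dist_eq h1
  have hzw : (G.induce s).Adj z ⟨w, hw⟩ := dist_eq_one_iff_adj.1 hz'
  exact ⟨z.1, z.2, hz, hzw⟩

/-- On an induced-or-shortcut path `a b c d` whose ends are at distance two, a midpoint of the
ends can be found on the path itself. -/
lemma adj_or_adj_of_path (hdh : DistHereditary G) {a b c d : V} (hab : G.Adj a b)
    (hbc : G.Adj b c) (hcd : G.Adj c d) (h : G.dist a d = 2) : G.Adj b d ∨ G.Adj a c := by
  have hs : (G.induce ({a, b, c, d} : Set V)).Connected := by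
    have hab' : (G.induce ({a, b, c, d} : Set V)).Adj ⟨a, by simp⟩ ⟨b, by simp⟩ := hab
    have hbc' : (G.induce ({a, b, c, d} : Set V)).Adj ⟨b, by simp⟩ ⟨c, by simp⟩ := hbc
    have hcd' : (G.induce ({a, b, c, d} : Set V)).Adj ⟨c, by simp⟩ ⟨d, by simp⟩ := hcd
    refine connected_induce_of_reachable (v := d) (by simp) ?_
    rintro y (rfl | rfl | rfl | rfl)
    · exact hab'.reachable.trans (hbc'.reachable.trans hcd'.reachable)
    · exact hbc'.reachable.trans hcd'.reachable
    · exact hcd'.reachable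
    · exact Reachable.refl _
  obtain ⟨z, hz, h1, h2⟩ := hdh.exists_common_neighbor hs (by simp) (by simp) h
  rcases hz with rfl | rfl | rfl | rfl
  · exact (G.irrefl h1).elim
  · exact Or.inl h2
  · exact Or.inr h1
  · exact (G.irrefl h2).elim

/-- Two neighbors `m`, `m'` of `c` that are one step closer to `v` than `c` have the same
neighbors one step closer still. -/
lemma adj_of_adj_of_dist (hdh : DistHereditary G) (hG : G.Connected) {c m m' q v : V} {k : ℕ}
    (hcm : G.Adj c m) (hcm' : G.Adj c m') (hqm : G.Adj q m) (hc : G.dist c v = k + 2)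
    (hm' : G.dist m' v = k + 1) (hq : G.dist q v = k) : G.Adj q m' := by
  let s : Set V := {z | G.dist z v ≤ k} ∪ {c, m'}
  have hball : ∀ z, G.dist z v ≤ k → z ∈ s := fun z hz => Or.inl hz
  have hvs : v ∈ s := hball v (by simp)
  have hcs : c ∈ s := by simp [s]
  have hms : m' ∈ s := by simp [s]
  have hm'r : (G.induce s).Reachable ⟨m', hms⟩ ⟨v, hvs⟩ := by
    obtain ⟨w, hw, hwk⟩ := exists_adj_dist_eq hm'
    have ha : (G.induce s).Adj ⟨m', hms⟩ ⟨w, hball w hwk.le⟩ := hw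
    exact ha.reachable.trans (hG.reachable_induce_of_ball_subset hball _ hvs hwk.le)
  have hs : (G.induce s).Connected := by
    refine connected_induce_of_reachable hvs ?_
    rintro y (hy | rfl | rfl)
    · exact hG.reachable_induce_of_ball_subset hball _ hvs hy
    · have ha : (G.induce s).Adj ⟨y, hcs⟩ ⟨m', hms⟩ := hcm'
      exact ha.reachable.trans hm'r
    · exact hm'r
  have hcq : G.dist c q = 2 := by
    have h1 := hG.dist_le_two hcm hqm.symm
    have h2 := hG.dist_triangle (u := c) (v := q) (w := v)
    omega
  obtain ⟨z, hz, h1, h2⟩ := hdh.exists_common_neighbor hs hcs (hball q hq.le) hcq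
  rcases hz with hz | rfl | rfl
  · have := hG.dist_le_succ_of_adj h1 v
    simp only [Set.mem_ofPred_eq] at hz
    omega
  · exact (G.irrefl h1).elim
  · exact h2.symm

lemma dist_le_of_opposite (hdh : DistHereditary G) (hG : G.Connected) {c m q v v' : V} {k : ℕ}
    (hcm : G.Adj c m) (hqm : G.Adj q m) (hcv : G.dist c v = k + 1)
    (hcv' : G.dist c v' = k + 3) (hqv' : G.dist q v' = k + 1)
    (hvv' : G.dist v v' ≤ 2 * k + 2) : G.dist q v ≤ k + 1 := by
  let s : Set V := ({z | G.dist z v ≤ k} ∪ {z | G.dist z v' ≤ k + 1}) ∪ {c}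
  have hball : ∀ z, G.dist z v ≤ k → z ∈ s := fun z hz => Or.inl (Or.inl hz)
  have hball' : ∀ z, G.dist z v' ≤ k + 1 → z ∈ s := fun z hz => Or.inl (Or.inr hz)
  have hvs : v ∈ s := hball v (by simp)
  have hvs' : v' ∈ s := hball' v' (by simp)
  have hcs : c ∈ s := Or.inr rfl
  have hv'v : (G.induce s).Reachable ⟨v', hvs'⟩ ⟨v, hvs⟩ := by
    obtain ⟨y, z, hy, hz, hyz⟩ := hG.exists_near_balls (a := k) (b := k + 1)
      (show G.dist v v' ≤ k + 1 + (k + 1) by omega)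
    have hzy : (G.induce s).Reachable ⟨z, hball' z hz⟩ ⟨y, hball y hy⟩ := by
      rcases hyz with rfl | hyz
      · exact Reachable.refl _
      · have ha : (G.induce s).Adj ⟨z, hball' z hz⟩ ⟨y, hball y hy⟩ := hyz.symm
        exact ha.reachable
    exact (hG.reachable_induce_of_ball_subset hball' _ hvs' hz).symm.trans
      (hzy.trans (hG.reachable_induce_of_ball_subset hball _ hvs hy))
  have hs : (G.induce s).Connected := by
    refine connected_induce_of_reachable hvs ?_
    rintro y ((hy | hy) | rfl)
    · exact hG.reachable_induce_of_ball_subset hball _ hvs hy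
    · exact (hG.reachable_induce_of_ball_subset hball' _ hvs' hy).trans hv'v
    · obtain ⟨w, hw, hwk⟩ := exists_adj_dist_eq hcv
      have ha : (G.induce s).Adj ⟨y, hcs⟩ ⟨w, hball w hwk.le⟩ := hw
      exact ha.reachable.trans (hG.reachable_induce_of_ball_subset hball _ hvs hwk.le)
  have hcq : G.dist c q = 2 := by
    have h1 := hG.dist_le_two hcm hqm.symm
    have h2 := hG.dist_triangle (u := c) (v := q) (w := v')
    omega
  obtain ⟨z, hz, h1, h2⟩ := hdh.exists_common_neighbor hs hcs (hball' q hqv'.le) hcq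
  rcases hz with (hz | hz) | rfl
  · have := hG.dist_le_succ_of_adj h2.symm v
    simp only [Set.mem_ofPred_eq] at hz
    omega
  · have := hG.dist_le_succ_of_adj h1 v'
    simp only [Set.mem_ofPred_eq] at hz
    omega
  · exact (G.irrefl h1).elim

/-- Vertices pairwise at distance two have a common neighbor. -/
lemma exists_adj_forall_of_pairwise [Finite V] [Nontrivial V] (hdh : DistHereditary G)
    (hG : G.Connected) {M : Set V} (hM : ∀ u ∈ M, ∀ v ∈ M, u ≠ v → G.dist u v = 2) :
    ∃ c, ∀ m ∈ M, G.Adj c m := by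
  obtain ⟨c, hc⟩ := Finite.exists_max fun c => {m ∈ M | G.Adj c m}.ncard
  refine ⟨c, fun m hm => by_contra fun hcm => ?_⟩
  obtain ⟨m₁, hm₁, hcm₁⟩ : {m ∈ M | G.Adj c m}.Nonempty := by
    obtain ⟨b, hb⟩ := hG.preconnected.exists_adj_of_nontrivial m
    have hpos : 0 < {x ∈ M | G.Adj b x}.ncard := (Set.ncard_pos).2 ⟨m, hm, hb.symm⟩
    exact (Set.ncard_pos).1 (hpos.trans_le (hc b))
  have hne : ∀ x ∈ M, G.Adj c x → x ≠ m := by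
    rintro x - hx rfl
    exact hcm hx
  obtain ⟨q, hq₁, hq⟩ := exists_adj_dist_eq (hM m₁ hm₁ m hm (hne m₁ hm₁ hcm₁))
  rw [dist_eq_one_iff_adj] at hq
  have hcm_ne : c ≠ m := by
    rintro rfl
    have := hM m₁ hm₁ c hm (hne m₁ hm₁ hcm₁)
    rw [dist_eq_one_iff_adj.2 hcm₁.symm] at this
    omega
  have hqx : ∀ x ∈ M, G.Adj c x → G.Adj q x := by
    intro x hx hcx
    have hxm := hM x hx m hm (hne x hx hcx)
    have hxm_adj : ¬ G.Adj x m := fun h => by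
      rw [dist_eq_one_iff_adj.2 h] at hxm
      omega
    have hm₁m_adj : ¬ G.Adj m₁ m := fun h => by
      have := hM m₁ hm₁ m hm (hne m₁ hm₁ hcm₁)
      rw [dist_eq_one_iff_adj.2 h] at this
      omega
    by_cases hcq : G.Adj c q
    · exact ((hdh.adj_or_adj_of_path hcx.symm hcq hq hxm).resolve_left hcm).symm
    · have h2 : G.dist c m ≠ 2 := fun h =>
        (hdh.adj_or_adj_of_path hcm₁ hq₁ hq h).elim hm₁m_adj hcq
      have h0 : G.dist c m ≠ 0 := fun h => hcm_ne (hG.dist_eq_zero_iff.1 h)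
      have h1 : G.dist c m ≠ 1 := fun h => hcm (dist_eq_one_iff_adj.1 h)
      have h3 : G.dist c m ≤ G.dist m₁ m + 1 := hG.dist_le_succ_of_adj hcm₁ m
      have h4 := hM m₁ hm₁ m hm (hne m₁ hm₁ hcm₁)
      exact hdh.adj_of_adj_of_dist hG (k := 1) hcm₁ hcx hq₁.symm (by omega) hxm
        (dist_eq_one_iff_adj.2 hq)
  refine absurd (hc q) (not_le.2 (Set.ncard_lt_ncard ?_))
  exact ⟨fun x hx => ⟨hx.1, hqx x hx.1 hx.2⟩, fun h => hcm (h ⟨hm, hq⟩).2⟩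

end DistHereditary

section Eccentricity

variable {V : Type*} [Fintype V] (G : SimpleGraph V)

lemma dist_le_ecc (u v : V) : G.dist u v ≤ ecc G u :=
  Finset.le_sup (f := fun v => G.dist u v) (Finset.mem_univ v)

lemma ecc_le_diam (u : V) : ecc G u ≤ diam G :=
  Finset.le_sup (f := fun v => ecc G v) (Finset.mem_univ u)

lemma rad_le_ecc (u : V) : rad G ≤ ecc G u :=
  Nat.sInf_le ⟨u, rfl⟩

lemma center_nonempty [Nonempty V] : (center G).Nonempty :=
  Nat.sInf_mem (Set.range_nonempty (ecc G))

variable {G}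

lemma mem_center_of_forall_dist_le {c : V} (h : ∀ v, G.dist c v ≤ rad G) : c ∈ center G :=
  le_antisymm (Finset.sup_le fun v _ => h v) (rad_le_ecc G c)

lemma dist_le_rad_of_mem_center {c : V} (h : c ∈ center G) (v : V) : G.dist c v ≤ rad G :=
  (dist_le_ecc G c v).trans_eq h

end Eccentricity

/-- In a finite connected distance-hereditary graph with
`diam(G) = 2·rad(G) − 2`, if `M ⊆ C(G)` and every two distinct vertices of `M` are at
distance 2, then some central vertex `c` is adjacent to every vertex of `M`. -/
theorem helly_like_centers {V : Type*} [Fintype V] (G : SimpleGraph V)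
    (hconn : G.Connected) (hdh : DistHereditary G)
    (hd : diam G + 2 = 2 * rad G) (M : Set V) (hM : M ⊆ center G)
    (hpairs : ∀ u ∈ M, ∀ v ∈ M, u ≠ v → G.dist u v = 2) :
    ∃ c ∈ center G, ∀ m ∈ M, G.Adj c m := by
  have := hconn.nonempty
  obtain ⟨x, hx⟩ := center_nonempty G
  rcases M.eq_empty_or_nonempty with rfl | ⟨m₀, hm₀⟩
  · exact ⟨x, hx, by simp⟩
  obtain ⟨k, hk⟩ : ∃ k, rad G = k + 2 := by
    have h1 := rad_le_ecc G x
    have h2 := ecc_le_diam G x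
    exact ⟨rad G - 2, by omega⟩
  have : Nontrivial V := by
    by_contra h
    rw [not_nontrivial_iff_subsingleton] at h
    have h0 : rad G ≤ 0 := (rad_le_ecc G x).trans
      (Finset.sup_le fun v _ => by simp [Subsingleton.elim x v])
    omega
  let X : Set V := {c | ∀ m ∈ M, G.Adj c m}
  let A (c : V) : Set V := {v | (∀ m ∈ M, G.dist m v = k + 2) ∧ G.dist c v = k + 1}
  obtain ⟨c, hcX, hc⟩ := X.toFinite.exists_maximalFor (fun c => (A c).ncard) X
    (hdh.exists_adj_forall_of_pairwise hconn hpairs)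
  refine ⟨c, mem_center_of_forall_dist_le fun v' => by_contra fun hlt => ?_, hcX⟩
  have hfar : ∀ m ∈ M, G.dist m v' = k + 2 ∧ G.dist c v' = k + 3 := by
    intro m hm
    have h1 := hconn.dist_le_succ_of_adj (hcX m hm) v'
    have h2 := dist_le_rad_of_mem_center (hM hm) v'
    omega
  have hcv' := (hfar m₀ hm₀).2
  obtain ⟨q, hq, hqv'⟩ := SimpleGraph.exists_adj_dist_eq (hfar m₀ hm₀).1
  have hqX : q ∈ X := fun m hm =>
    hdh.adj_of_adj_of_dist hconn (hcX m₀ hm₀) (hcX m hm) hq.symm hcv' (hfar m hm).1 hqv'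
  have hlt : (A c).ncard < (A q).ncard := by
    refine Set.ncard_lt_ncard ⟨fun v hv => ⟨hv.1, ?_⟩, fun h => ?_⟩
    · have hvv' : G.dist v v' ≤ 2 * k + 2 := by
        have h1 := (dist_le_ecc G v v').trans (ecc_le_diam G v)
        omega
      have h1 := hdh.dist_le_of_opposite hconn (hcX m₀ hm₀) hq.symm hv.2 hcv' hqv' hvv'
      have h2 := hconn.dist_le_succ_of_adj hq v
      have h3 := hv.1 m₀ hm₀
      omega
    · have h1 : G.dist c v' = k + 1 := (h ⟨fun m hm => (hfar m hm).1, hqv'⟩).2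
      omega
  exact absurd (hc hqX hlt.le) (not_le.2 hlt)
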